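/- arXiv:1907.13350 — 5 statements merged into one kernel-verified Lean document; each statement's English description precedes it below -/
import Mathlib

section
/- Let (X, ν) be a measure space with ν a finite measure, let m and k be positive natural numbers, and let U_1, …, U_k be measurable subsets of X with ν(U_i) > 0 for all i, such that for ν-almost every x ∈ X the number of indices i with x ∈ U_i is exactly m. Define the k × k real matrix B by B_{ij} = ν(U_i ∩ U_j) / √(ν(U_i) · ν(U_j)), set μ_{ij} = ν(U_i ∩ U_j) for i ≠ j and μ_{ii} = 0, and set d_i = Σ_j μ_{ij}. Then m·I − B = (m − 1)·Λ, where Λ is the k × k matrix with entries Λ_{ij} = δ_{ij} − μ_{ij} / √(d_i · d_j); that is, (m·I − B)_{ii} = m − 1 and (m·I − B)_{ij} = −(m − 1)·μ_{ij} / √(d_i d_j) for i ≠ j. -/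
open MeasureTheory
open scoped ENNReal

theorem stmt_3_sum {X : Type*} [MeasurableSpace X] (ν : Measure X) [IsFiniteMeasure ν]
    (m k : ℕ) (U : Fin k → Set X) (hU : ∀ i, MeasurableSet (U i))
    (hcov : ∀ᵐ x ∂ν, Nat.card {i : Fin k // x ∈ U i} = m) (i : Fin k) :
    ∑ j, (ν (U i ∩ U j)).toReal = m * (ν (U i)).toReal := by
  classical
  have h1 : ∑ j, ν (U i ∩ U j) = m * ν (U i) := by
    calc ∑ j, ν (U i ∩ U j) = ∑ j, ∫⁻ x in U i, (U j).indicator 1 x ∂ν := by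
          refine Finset.sum_congr rfl fun j _ => ?_
          rw [lintegral_indicator_one (hU j), Measure.restrict_apply (hU j), Set.inter_comm]
      _ = ∫⁻ x in U i, ∑ j, (U j).indicator 1 x ∂ν := by
          rw [lintegral_finsetSum]
          exact fun j _ => measurable_one.indicator (hU j)
      _ = ∫⁻ x in U i, (m : ℝ≥0∞) ∂ν := by
          refine lintegral_congr_ae ?_
          filter_upwards [ae_restrict_of_ae hcov] with x hx
          rw [← hx, Nat.card_eq_fintype_card, Fintype.card_subtype]
          simp [Set.indicator_apply]
      _ = m * ν (U i) := by simp
  rw [← ENNReal.toReal_sum (fun j _ => measure_ne_top _ _), h1]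
  simp

/-- For an `m`-fold cover `(U i)` of a finite measure space, with
`B i j = ν (U i ∩ U j) / √(ν (U i) · ν (U j))`, `μ i j = ν (U i ∩ U j)` for `i ≠ j`,
`μ i i = 0`, and `d i = ∑ j, μ i j`, one has `m • I - B = (m - 1) • Λ`,
where `Λ` is the symmetric normalized Laplacian `Λ i j = δ_{ij} - μ i j / √(d i · d j)`. -/
theorem stmt_3 {X : Type*} [MeasurableSpace X] (ν : Measure X) [IsFiniteMeasure ν]
    (m k : ℕ) (hm : 0 < m) (hk : 0 < k) (U : Fin k → Set X)
    (hU : ∀ i, MeasurableSet (U i)) (hpos : ∀ i, 0 < ν (U i))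
    (hcov : ∀ᵐ x ∂ν, Nat.card {i : Fin k // x ∈ U i} = m)
    (B : Matrix (Fin k) (Fin k) ℝ)
    (hB : ∀ i j, B i j = (ν (U i ∩ U j)).toReal
      / Real.sqrt ((ν (U i)).toReal * (ν (U j)).toReal))
    (μ : Fin k → Fin k → ℝ)
    (hμ : ∀ i j, μ i j = if i = j then 0 else (ν (U i ∩ U j)).toReal)
    (d : Fin k → ℝ) (hd : ∀ i, d i = ∑ j, μ i j)
    (Λ : Matrix (Fin k) (Fin k) ℝ)
    (hΛ : ∀ i j, Λ i j = (if i = j then 1 else 0) - μ i j / Real.sqrt (d i * d j)) :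
    (m : ℝ) • (1 : Matrix (Fin k) (Fin k) ℝ) - B = ((m : ℝ) - 1) • Λ := by
  classical
  have hdi : ∀ i, d i = ((m : ℝ) - 1) * (ν (U i)).toReal := by
    intro i
    have h := stmt_3_sum ν m k U hU hcov i
    have h2 : ∀ j, μ i j = (ν (U i ∩ U j)).toReal - if i = j then (ν (U i)).toReal else 0 := by
      intro j
      rw [hμ]
      split_ifs with hij
      · subst hij; simp
      · simp
    rw [hd, Finset.sum_congr rfl (fun j _ => h2 j), Finset.sum_sub_distrib, h]
    simp
    ring
  have hp : ∀ i, 0 < (ν (U i)).toReal := fun i =>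
    ENNReal.toReal_pos (hpos i).ne' (measure_ne_top _ _)
  have hm1 : (0 : ℝ) ≤ (m : ℝ) - 1 := by
    have : (1 : ℝ) ≤ m := by exact_mod_cast hm
    linarith
  ext i j
  simp only [Matrix.sub_apply, Matrix.smul_apply, smul_eq_mul, hB, hΛ, Matrix.one_apply]
  by_cases hij : i = j
  · subst hij
    have := (hp i).ne'
    simp [hμ, Real.sqrt_mul_self (hp i).le, this]
  · have e : (ν (U i ∩ U j)).toReal = μ i j := by simp [hμ, hij]
    rw [e]
    simp only [hij, if_false]
    rcases hm1.eq_or_lt with h0 | h0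
    · have hz : ∑ j, μ i j = 0 := by rw [← hd, hdi, ← h0, zero_mul]
      have hn : ∀ j ∈ Finset.univ, 0 ≤ μ i j := by
        intro j _
        rw [hμ]
        split_ifs <;> simp
      have := (Finset.sum_eq_zero_iff_of_nonneg hn).1 hz j (Finset.mem_univ j)
      simp [this]
    · have hs : Real.sqrt (d i * d j)
          = ((m : ℝ) - 1) * Real.sqrt ((ν (U i)).toReal * (ν (U j)).toReal) := by
        rw [hdi, hdi, mul_mul_mul_comm, Real.sqrt_mul (mul_self_nonneg _),
          Real.sqrt_mul_self hm1]
      have hq : 0 < Real.sqrt ((ν (U i)).toReal * (ν (U j)).toReal) :=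
        Real.sqrt_pos.2 (mul_pos (hp i) (hp j))
      rw [hs]
      field_simp
      ring
end

section
/- Let H be an infinite-dimensional real Hilbert space, let k be a positive natural number, let Φ : H → ℝ^k (Euclidean) be a continuous linear map with adjoint Φ*, and let m be a real number. Let μ_1 ≤ μ_2 ≤ … ≤ μ_k be the eigenvalues, counted with multiplicity, of the symmetric k × k matrix m·I − Φ Φ* (the matrix of the operator m·id − Φ Φ* in the standard basis). Then for every i ∈ {1, …, k}: the infimum, over all i-dimensional linear subspaces V of H, of sup{ (m·‖f‖² − ‖Φ f‖²)/‖f‖² : f ∈ V, f ≠ 0 } equals μ_i. -/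
/-- Let `H` be an infinite-dimensional real Hilbert space,
`Φ : H → ℝᵏ` a continuous linear map with adjoint `Φ*`, and `m : ℝ`. If
`μ 1 ≤ … ≤ μ k` are the eigenvalues (with multiplicity, encoded by an orthonormal
eigenbasis `b`) of the symmetric operator `m • I - Φ Φ*`, then for each `i`,
the infimum over all `(i+1)`-dimensional subspaces `V ⊆ H` of
`sup { (m ‖f‖² - ‖Φ f‖²)/‖f‖² : f ∈ V, f ≠ 0 }` equals `μ i`. -/
theorem stmt_4 {H : Type*} [NormedAddCommGroup H] [InnerProductSpace ℝ H]
    [CompleteSpace H] (hH : ¬ FiniteDimensional ℝ H)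
    (k : ℕ) (hk : 0 < k) (Φ : H →L[ℝ] EuclideanSpace ℝ (Fin k)) (m : ℝ)
    (μ : Fin k → ℝ) (hmono : Monotone μ)
    (b : OrthonormalBasis (Fin k) ℝ (EuclideanSpace ℝ (Fin k)))
    (hb : ∀ i, (m • ContinuousLinearMap.id ℝ (EuclideanSpace ℝ (Fin k))
        - Φ ∘L ContinuousLinearMap.adjoint Φ) (b i) = μ i • b i) :
    ∀ i : Fin k,
      (⨅ V : {V : Submodule ℝ H // Module.finrank ℝ V = (i : ℕ) + 1},
        ⨆ f : {f : H // f ∈ V.1 ∧ f ≠ 0},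
          (m * ‖f.1‖ ^ 2 - ‖Φ f.1‖ ^ 2) / ‖f.1‖ ^ 2) = μ i := by
  intro i
  set A := ContinuousLinearMap.adjoint Φ with hA
  have hE : ∀ j, Φ (A (b j)) = (m - μ j) • b j := by
    intro j
    have h := hb j
    simp only [ContinuousLinearMap.sub_apply, ContinuousLinearMap.smul_apply,
      ContinuousLinearMap.id_apply, ContinuousLinearMap.comp_apply] at h
    rw [sub_smul, ← h]; abel
  have hadj : ∀ g f, inner ℝ (A g) f = inner ℝ g (Φ f) := fun g f =>
    ContinuousLinearMap.adjoint_inner_left Φ f g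
  have hadj' : ∀ g f, inner ℝ f (A g) = inner ℝ (Φ f) g := fun g f =>
    ContinuousLinearMap.adjoint_inner_right Φ f g
  have hcoord : ∀ g j, inner ℝ (b j) (Φ (A g)) = (m - μ j) * inner ℝ (b j) g := by
    intro g j
    rw [← hadj, hadj', hE, real_inner_smul_left]
  have hn : ∀ g, ‖g‖ ^ 2 = ∑ j, (inner ℝ (b j) g) ^ 2 := by
    intro g
    rw [← b.sum_sq_norm_inner_right g]
    simp
  have hnA : ∀ g, ‖A g‖ ^ 2 = ∑ j, (m - μ j) * (inner ℝ (b j) g) ^ 2 := by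
    intro g
    rw [← real_inner_self_eq_norm_sq, hadj, ← b.sum_inner_mul_inner]
    refine Finset.sum_congr rfl fun j _ => ?_
    rw [hcoord, real_inner_comm]; ring
  have hnΦ : ∀ g, ‖Φ (A g)‖ ^ 2 = ∑ j, (m - μ j) ^ 2 * (inner ℝ (b j) g) ^ 2 := by
    intro g
    rw [hn]
    refine Finset.sum_congr rfl fun j _ => ?_
    rw [hcoord]; ring
  have hlam : ∀ j, ‖A (b j)‖ ^ 2 = m - μ j := by
    intro j
    rw [← real_inner_self_eq_norm_sq, hadj, hE, real_inner_smul_right,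
      real_inner_self_eq_norm_sq, b.norm_eq_one]
    ring
  have hlam0 : ∀ j, 0 ≤ m - μ j := fun j => by rw [← hlam j]; positivity
  have hbdd : ∀ V : Submodule ℝ H, BddAbove (Set.range fun f : {f : H // f ∈ V ∧ f ≠ 0} =>
      (m * ‖f.1‖ ^ 2 - ‖Φ f.1‖ ^ 2) / ‖f.1‖ ^ 2) := by
    intro V
    refine ⟨m, ?_⟩
    rintro _ ⟨⟨f, hf, h0⟩, rfl⟩
    have : 0 < ‖f‖ ^ 2 := by have := norm_pos_iff.2 h0; positivity
    simp only
    rw [div_le_iff₀ this]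
    nlinarith [sq_nonneg ‖Φ f‖]
  -- lower bound
  have hlow : ∀ V : {V : Submodule ℝ H // Module.finrank ℝ V = (i : ℕ) + 1},
      μ i ≤ ⨆ f : {f : H // f ∈ V.1 ∧ f ≠ 0},
          (m * ‖f.1‖ ^ 2 - ‖Φ f.1‖ ^ 2) / ‖f.1‖ ^ 2 := by
    rintro ⟨V, hV⟩
    have hfd : FiniteDimensional ℝ V := FiniteDimensional.of_finrank_pos (by omega)
    let L : V →ₗ[ℝ] (Set.Iio i → ℝ) := LinearMap.pi fun j =>
      ((innerSL ℝ (b j.1)).comp Φ).toLinearMap.comp V.subtype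
    have hker : LinearMap.ker L ≠ ⊥ := by
      apply LinearMap.ker_ne_bot_of_finrank_lt
      rw [hV]; simp
    obtain ⟨⟨f, hfV⟩, hfk, hf0⟩ := Submodule.exists_mem_ne_zero_of_ne_bot hker
    have hf0 : f ≠ 0 := fun h => hf0 (Subtype.ext h)
    have hz : ∀ j, j < i → inner ℝ (b j) (Φ f) = 0 := by
      intro j hj
      exact congrFun (LinearMap.mem_ker.1 hfk) ⟨j, hj⟩
    refine le_ciSup_of_le (hbdd V) ⟨f, hfV, hf0⟩ ?_
    have hpos : 0 < ‖f‖ ^ 2 := by have := norm_pos_iff.2 hf0; positivity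
    simp only
    rw [le_div_iff₀ hpos]
    have h1 : ‖A (Φ f)‖ ^ 2 ≤ (m - μ i) * ‖Φ f‖ ^ 2 := by
      rw [hnA, hn, Finset.mul_sum]
      refine Finset.sum_le_sum fun j _ => ?_
      rcases lt_or_ge j i with h | h
      · simp [hz j h]
      · have := hmono h
        gcongr
    have h2 : ‖Φ f‖ ^ 2 ≤ ‖f‖ * ‖A (Φ f)‖ := by
      rw [← real_inner_self_eq_norm_sq, ← hadj']
      exact real_inner_le_norm _ _
    have h3 : ‖Φ f‖ ^ 2 ≤ (m - μ i) * ‖f‖ ^ 2 := by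
      rcases (sq_nonneg ‖Φ f‖).eq_or_lt with h | h
      · rw [← h]; exact mul_nonneg (hlam0 i) (sq_nonneg _)
      · refine le_of_mul_le_mul_right ?_ h
        calc ‖Φ f‖ ^ 2 * ‖Φ f‖ ^ 2 ≤ (‖f‖ * ‖A (Φ f)‖) * (‖f‖ * ‖A (Φ f)‖) := by gcongr
          _ = ‖f‖ ^ 2 * ‖A (Φ f)‖ ^ 2 := by ring
          _ ≤ ‖f‖ ^ 2 * ((m - μ i) * ‖Φ f‖ ^ 2) := by gcongr
          _ = _ := by ring
    linarith
  -- optimal subspace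
  have hex : ∃ V : Submodule ℝ H, Module.finrank ℝ V = (i : ℕ) + 1 ∧
      ∀ f ∈ V, (m - μ i) * ‖f‖ ^ 2 ≤ ‖Φ f‖ ^ 2 := by
    rcases (hlam0 i).eq_or_lt with h0 | hpos
    · have hr : (((i : ℕ) + 1 : ℕ) : Cardinal) ≤ Module.rank ℝ H := by
        have : Cardinal.aleph0 ≤ Module.rank ℝ H := by
          by_contra h
          exact hH (Module.rank_lt_aleph0_iff.1 (not_le.1 h))
        exact (Cardinal.natCast_lt_aleph0).le.trans this
      obtain ⟨s, hs, hli⟩ := le_rank_iff_exists_linearIndependent_finset.1 hr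
      refine ⟨Submodule.span ℝ (s : Set H), ?_, ?_⟩
      · rw [finrank_span_finset_eq_card hli, hs]
      · intro f _
        rw [← h0]; simp
    · let W : Submodule ℝ (EuclideanSpace ℝ (Fin k)) :=
        Submodule.span ℝ (Set.range fun j : Set.Iic i => b j.1)
      have hz : ∀ g ∈ W, ∀ j, i < j → inner ℝ (b j) g = 0 := by
        intro g hg j hj
        induction hg using Submodule.span_induction with
        | mem x hx =>
          obtain ⟨l, rfl⟩ := hx
          exact b.orthonormal.2 (lt_of_le_of_lt l.2 hj).ne'
        | zero => simp
        | add x y _ _ hx hy => rw [inner_add_right, hx, hy, add_zero]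
        | smul c x _ hx => rw [real_inner_smul_right, hx, mul_zero]
      refine ⟨W.map A.toLinearMap, ?_, ?_⟩
      · have hW : W.map A.toLinearMap =
            Submodule.span ℝ (Set.range fun j : Set.Iic i => A (b j.1)) := by
          rw [Submodule.map_span, ← Set.range_comp]; rfl
        rw [hW, finrank_span_eq_card]
        · simp
        · apply linearIndependent_of_ne_zero_of_inner_eq_zero (𝕜 := ℝ)
          · rintro ⟨j, hj⟩ h
            have h1 := hlam j
            have h2 := hmono hj
            simp only at h
            rw [h, norm_zero] at h1
            norm_num at h1
            linarith
          · intro j l hjl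
            rw [hadj, hE, real_inner_smul_right,
              b.orthonormal.2 (fun h => hjl (Subtype.ext h)), mul_zero]
      · rintro _ ⟨g, hg, rfl⟩
        change (m - μ i) * ‖A g‖ ^ 2 ≤ ‖Φ (A g)‖ ^ 2
        rw [hnA, hnΦ, Finset.mul_sum]
        refine Finset.sum_le_sum fun j _ => ?_
        rcases lt_or_ge i j with h | h
        · simp [hz g hg j h]
        · have h1 := hmono h
          rw [← mul_assoc, sq (m - μ j)]
          have := hlam0 j
          gcongr
  obtain ⟨V, hV, hVf⟩ := hex
  haveI : Nonempty {V : Submodule ℝ H // Module.finrank ℝ V = (i : ℕ) + 1} := ⟨⟨V, hV⟩⟩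
  refine le_antisymm ?_ (le_ciInf hlow)
  refine ciInf_le_of_le ⟨μ i, ?_⟩ ⟨V, hV⟩ ?_
  · rintro _ ⟨V, rfl⟩
    exact hlow V
  · have hne : V ≠ ⊥ := by
      rintro rfl
      simp at hV
    obtain ⟨f₀, hf₀, hf₀'⟩ := Submodule.exists_mem_ne_zero_of_ne_bot hne
    haveI : Nonempty {f : H // f ∈ V ∧ f ≠ 0} := ⟨⟨f₀, hf₀, hf₀'⟩⟩
    refine ciSup_le ?_
    rintro ⟨f, hf, h0⟩
    have hpos : 0 < ‖f‖ ^ 2 := by have := norm_pos_iff.2 h0; positivity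
    simp only
    rw [div_le_iff₀ hpos]
    linarith [hVf f hf]
end

section
/- Let a ≥ 1 be a real number and let Γ₂ be the weighted 4-cycle on vertices 1, 2, 3, 4 with edge weights μ(1,2) = a, μ(2,3) = 1, μ(3,4) = a, μ(4,1) = 1 (and all other weights zero). Then the second-smallest eigenvalue of the symmetric normalized Laplacian of Γ₂ equals 2/(a+1); indeed its eigenvalues counted with multiplicity are 0, 2/(a+1), 2a/(a+1), 2. -/
open Polynomial

/-- Let `a ≥ 1` and let `Γ₂` be the weighted 4-cycle on vertices
`1, 2, 3, 4` (indexed here by `0, 1, 2, 3`) with edge weights `μ(1,2) = a`,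
`μ(2,3) = 1`, `μ(3,4) = a`, `μ(4,1) = 1`. Then the eigenvalues of its symmetric
normalized Laplacian, counted with multiplicity and listed increasingly, are
`0, 2/(a+1), 2a/(a+1), 2`; in particular the second-smallest eigenvalue equals
`2/(a+1)`. The eigenvalue list is encoded through the characteristic polynomial. -/
theorem stmt_11 (a : ℝ) (ha : 1 ≤ a)
    (μ : Fin 4 → Fin 4 → ℝ)
    (hμ : μ = ![![0, a, 0, 1], ![a, 0, 1, 0], ![0, 1, 0, a], ![1, 0, a, 0]])
    (d : Fin 4 → ℝ) (hd : ∀ i, d i = ∑ j, μ i j)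
    (Λ : Matrix (Fin 4) (Fin 4) ℝ)
    (hΛ : ∀ i j, Λ i j = (if i = j then 1 else 0) - μ i j / Real.sqrt (d i * d j)) :
    Λ.charpoly = ∏ i : Fin 4,
      (X - C (![0, 2 / (a + 1), 2 * a / (a + 1), 2] i)) := by
  have h1 : a + 1 ≠ 0 := by positivity
  have hd' : ∀ i, d i = a + 1 := by
    intro i
    rw [hd, hμ]
    fin_cases i <;> simp [Fin.sum_univ_four] <;> ring
  have hs : Real.sqrt ((a + 1) * (a + 1)) = a + 1 :=
    Real.sqrt_mul_self (by positivity)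
  obtain ⟨q, hq⟩ : ∃ q, q = 1 / (a + 1) := ⟨_, rfl⟩
  have hp : a / (a + 1) = 1 - q := by rw [hq]; field_simp; ring
  have e1 : 2 / (a + 1) = 2 * q := by rw [hq]; ring
  have e2 : 2 * a / (a + 1) = 2 * (1 - q) := by rw [← hp]; ring
  have hM : Λ = !![1, -(1 - q), 0, -q; -(1 - q), 1, -q, 0;
      0, -q, 1, -(1 - q); -q, 0, -(1 - q), 1] := by
    ext i j
    rw [hΛ, hd', hd', hs, hμ]
    fin_cases i <;> fin_cases j <;> simp [hp, ← hq] <;> simp [hq]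
  have hc : Λ.charmatrix = !![X - 1, 1 - C q, 0, C q; 1 - C q, X - 1, C q, 0;
      0, C q, X - 1, 1 - C q; C q, 0, 1 - C q, X - 1] := by
    ext1 i j
    rw [hM]
    fin_cases i <;> fin_cases j <;> simp [Matrix.charmatrix_apply]
  have hC2 : (C (2 : ℝ) : ℝ[X]) = 2 := rfl
  rw [e1, e2, Matrix.charpoly, hc, Matrix.det_succ_row_zero]
  simp [Fin.sum_univ_four, Matrix.det_fin_three, Fin.succAbove, Fin.prod_univ_four, hC2]
  ring
end

section
/- Let Γ be the weighted complete graph on the vertex set Fin 3 × Fin 4 with edge weights μ(u,v) = 2 if u ≠ v and u, v have the same first coordinate, μ(u,v) = 3 if u and v have different first coordinates, and μ(u,u) = 0. Then every vertex of Γ has weighted degree 30, and the eigenvalues of the symmetric normalized Laplacian of Γ, counted with multiplicity, are: 0 with multiplicity 1, 16/15 with multiplicity 9, and 6/5 with multiplicity 2. In particular the second-smallest eigenvalue equals 16/15. -/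
open Polynomial

/-- Rational model of the Laplacian. -/
def lapQ : Matrix (Fin 3 × Fin 4) (Fin 3 × Fin 4) ℚ := fun u v =>
  (if u = v then 1 else 0) - (if u = v then 0 else if u.1 = v.1 then 2 else 3) / 30

/-- Eigenbasis of the all-ones matrix. -/
def eigB (n : ℕ) : Matrix (Fin (n + 1)) (Fin (n + 1)) ℚ := fun i k =>
  if k = 0 then 1 else (if i = 0 then 1 else 0) - (if i = k then 1 else 0)

/-- Inverse of `eigB`. -/
def eigBinv (n : ℕ) : Matrix (Fin (n + 1)) (Fin (n + 1)) ℚ := fun k i =>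
  if k = 0 then 1 / (n + 1) else 1 / (n + 1) - (if i = k then 1 else 0)

def eigP : Matrix (Fin 3 × Fin 4) (Fin 3 × Fin 4) ℚ := fun u v =>
  eigB 2 u.1 v.1 * eigB 3 u.2 v.2

def eigQ : Matrix (Fin 3 × Fin 4) (Fin 3 × Fin 4) ℚ := fun u v =>
  eigBinv 2 u.1 v.1 * eigBinv 3 u.2 v.2

def eigD : Fin 3 × Fin 4 → ℚ := fun u =>
  if u.2 = 0 then (if u.1 = 0 then 0 else 6 / 5) else 16 / 15

lemma eigQ_mul_eigP : eigQ * eigP = 1 := by decide +kernel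

lemma lapQ_mul_eigP : lapQ * eigP = eigP * Matrix.diagonal eigD := by decide +kernel

lemma lapQ_charpoly : lapQ.charpoly = X * (X - C (16 / 15)) ^ 9 * (X - C (6 / 5)) ^ 2 := by
  have hPQ : eigP * eigQ = 1 := mul_eq_one_comm.mp eigQ_mul_eigP
  have h : lapQ = eigP * (Matrix.diagonal eigD * eigQ) := by
    rw [← Matrix.mul_assoc, ← lapQ_mul_eigP, Matrix.mul_assoc, hPQ, Matrix.mul_one]
  rw [h, Matrix.charpoly_mul_comm, Matrix.mul_assoc, eigQ_mul_eigP, Matrix.mul_one,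
    Matrix.charpoly_diagonal, Fintype.prod_prod_type]
  simp [Fin.prod_univ_succ, eigD]
  ring

/-- Let `Γ` be the weighted complete graph on `Fin 3 × Fin 4` with
edge weights `2` between distinct vertices sharing the same first coordinate and `3`
between vertices with different first coordinates. Then every vertex has weighted
degree `30`, and the eigenvalues of the symmetric normalized Laplacian, counted with
multiplicity and listed increasingly, are `0¹, (16/15)⁹, (6/5)²`; in particular the
second-smallest eigenvalue equals `16/15`. The eigenvalue list is encoded through the
characteristic polynomial. -/
theorem stmt_13 (μ : Fin 3 × Fin 4 → Fin 3 × Fin 4 → ℝ)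
    (hμ : ∀ u v, μ u v = if u = v then 0 else if u.1 = v.1 then 2 else 3)
    (d : Fin 3 × Fin 4 → ℝ) (hd : ∀ u, d u = ∑ v, μ u v)
    (Λ : Matrix (Fin 3 × Fin 4) (Fin 3 × Fin 4) ℝ)
    (hΛ : ∀ u v, Λ u v = (if u = v then 1 else 0) - μ u v / Real.sqrt (d u * d v)) :
    (∀ u, d u = 30) ∧
    Λ.charpoly = ∏ i : Fin 12,
      (X - C (![0, 16 / 15, 16 / 15, 16 / 15, 16 / 15, 16 / 15, 16 / 15, 16 / 15,
        16 / 15, 16 / 15, 6 / 5, 6 / 5] i)) := by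
  have hdeg : ∀ u, d u = 30 := by
    intro u
    have key : ∀ u : Fin 3 × Fin 4,
        ∑ v : Fin 3 × Fin 4, (if u = v then 0 else if u.1 = v.1 then 2 else 3 : ℕ) = 30 := by
      decide +kernel
    have h := congrArg (Nat.cast : ℕ → ℝ) (key u)
    push_cast at h
    rw [hd]
    simp only [hμ]
    exact h
  refine ⟨hdeg, ?_⟩
  have hL : Λ = lapQ.map (algebraMap ℚ ℝ) := by
    ext u v
    rw [hΛ, hμ, hdeg, hdeg, Real.sqrt_mul_self (by norm_num)]
    simp only [lapQ, Matrix.map_apply]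
    split_ifs <;> simp
  rw [hL, Matrix.charpoly_map, lapQ_charpoly]
  simp [Fin.prod_univ_succ, Polynomial.map_pow]
  ring
end

section
/- Let n ≥ 1 and let Γ be the weighted path graph on vertices 0, 1, …, n with edge weights μ(i−1, i) = w_i > 0 for i = 1, …, n (and all other weights zero). Then the second-smallest eigenvalue α₂(Γ) of the symmetric normalized Laplacian of Γ satisfies α₂(Γ) ≥ 2 / ( (Σ_{i=1}^{n} w_i) · (Σ_{i=1}^{n} 1/w_i) ). -/
open Polynomial

lemma aux_mu (n : ℕ) (w : Fin n → ℝ) (μ : Fin (n + 1) → Fin (n + 1) → ℝ)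
    (ha : ∀ k : Fin n, μ k.castSucc k.succ = w k)
    (hb : ∀ k : Fin n, μ k.succ k.castSucc = w k)
    (hc : ∀ i j : Fin (n + 1), (i : ℕ) + 1 ≠ (j : ℕ) → (j : ℕ) + 1 ≠ (i : ℕ) → μ i j = 0)
    (i j : Fin (n + 1)) :
    μ i j = ∑ k : Fin n, ((if i = k.castSucc then (if j = k.succ then w k else 0) else 0)
      + (if i = k.succ then (if j = k.castSucc then w k else 0) else 0)) := by
  by_cases h : (i : ℕ) + 1 = (j : ℕ)
  · obtain ⟨k, rfl, rfl⟩ : ∃ k : Fin n, i = k.castSucc ∧ j = k.succ := by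
      have hl : (i : ℕ) < n := by have := j.isLt; omega
      refine ⟨⟨i, hl⟩, ?_, ?_⟩
      · ext; simp
      · ext; simp [h]
    rw [ha, Finset.sum_eq_single k]
    · have h3 : ¬ k.castSucc = k.succ := by
        intro h; have := congrArg Fin.val h; simp at this
      rw [if_pos rfl, if_pos rfl, if_neg h3, add_zero]
    · intro l _ hl
      have h1 : ¬ k.castSucc = l.castSucc := by
        intro h; exact hl (Fin.castSucc_injective n h).symm
      have h3 : ¬ (k.castSucc = l.succ ∧ k.succ = l.castSucc) := by
        rintro ⟨h1, h2⟩
        have := congrArg Fin.val h1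
        have := congrArg Fin.val h2
        simp at *
        omega
      rw [if_neg h1, ← ite_and, if_neg h3, add_zero]
    · simp
  by_cases h' : (j : ℕ) + 1 = (i : ℕ)
  · obtain ⟨k, rfl, rfl⟩ : ∃ k : Fin n, j = k.castSucc ∧ i = k.succ := by
      have hl : (j : ℕ) < n := by have := i.isLt; omega
      refine ⟨⟨j, hl⟩, ?_, ?_⟩
      · ext; simp
      · ext; simp [h']
    rw [hb, Finset.sum_eq_single k]
    · have h3 : ¬ k.succ = k.castSucc := by
        intro h; have := congrArg Fin.val h; simp at this
      rw [if_neg h3, if_pos rfl, if_pos rfl, zero_add]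
    · intro l _ hl
      have h1 : ¬ k.castSucc = l.castSucc := by
        intro h; exact hl (Fin.castSucc_injective n h).symm
      have h3 : ¬ (k.succ = l.castSucc ∧ k.castSucc = l.succ) := by
        rintro ⟨h1, h2⟩
        have := congrArg Fin.val h1
        have := congrArg Fin.val h2
        simp at *
        omega
      rw [if_neg h1, ite_self, ← ite_and, if_neg h3, add_zero]
    · simp
  · rw [hc i j h h']
    symm
    apply Finset.sum_eq_zero
    intro k _
    have h1 : ¬ (i = k.castSucc ∧ j = k.succ) := by
      rintro ⟨rfl, rfl⟩; simp at h
    have h3 : ¬ (i = k.succ ∧ j = k.castSucc) := by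
      rintro ⟨rfl, rfl⟩; simp at h'
    rw [← ite_and, ← ite_and, if_neg h1, if_neg h3, add_zero]

lemma aux_sum (n : ℕ) (w : Fin n → ℝ) (μ : Fin (n + 1) → Fin (n + 1) → ℝ)
    (hμ : ∀ i j, μ i j = ∑ k : Fin n,
      ((if i = k.castSucc then (if j = k.succ then w k else 0) else 0)
      + (if i = k.succ then (if j = k.castSucc then w k else 0) else 0)))
    (F : Fin (n + 1) → Fin (n + 1) → ℝ) :
    ∑ i, ∑ j, μ i j * F i j = ∑ k : Fin n, w k * (F k.castSucc k.succ + F k.succ k.castSucc) := by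
  simp_rw [hμ, Finset.sum_mul]
  have : ∀ i : Fin (n+1), ∀ G : Fin (n+1) → Fin n → ℝ,
    ∑ j, ∑ k, G j k = ∑ k, ∑ j, G j k := fun i G => Finset.sum_comm
  rw [Finset.sum_congr rfl (fun i _ => Finset.sum_comm), Finset.sum_comm]
  refine Finset.sum_congr rfl fun k _ => ?_
  simp only [add_mul, ite_mul, zero_mul, Finset.sum_add_distrib]
  have e : ∀ (a b : Fin (n+1)), ∑ i, ∑ j, (if i = a then (if j = b then w k * F i j else 0) else 0)
      = w k * F a b := by
    intro a b
    rw [Finset.sum_eq_single a]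
    · simp
    · intro i _ hi; simp [hi]
    · simp
  rw [e, e]; ring

lemma aux_tele (n : ℕ) (f : Fin (n + 1) → ℝ) (i : Fin (n + 1)) :
    f i = f 0 + ∑ k : Fin n, (f k.succ - f k.castSucc) * (if k.castSucc < i then 1 else 0) := by
  induction i using Fin.induction with
  | zero => simp
  | succ i ih =>
    have : ∀ k : Fin n, (f k.succ - f k.castSucc) * (if k.castSucc < i.succ then 1 else 0)
        = (f k.succ - f k.castSucc) * (if k.castSucc < i.castSucc then 1 else 0)
          + (if k = i then (f k.succ - f k.castSucc) else 0) := by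
      intro k
      rcases lt_trichotomy k i with h | h | h
      · have h1 : k.castSucc < i.succ := by rw [Fin.lt_def] at *; simp; omega
        have h2 : k.castSucc < i.castSucc := by rw [Fin.lt_def] at *; simp; omega
        simp only [h1, h2, h.ne, if_true, if_false, add_zero]
      · subst h
        have h1 : k.castSucc < k.succ := by rw [Fin.lt_def] at *; simp
        simp only [h1, lt_irrefl, if_true, if_false]; ring
      · have h1 : ¬ k.castSucc < i.succ := by rw [Fin.lt_def] at *; simp; omega
        have h2 : ¬ k.castSucc < i.castSucc := by rw [Fin.lt_def] at *; simp; omega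
        simp only [h1, h2, h.ne', if_false, add_zero]
    simp_rw [this, Finset.sum_add_distrib]
    simp only [Finset.sum_ite_eq', Finset.mem_univ, if_true]
    linarith

lemma aux_pair {ι : Type*} [Fintype ι] (d f : ι → ℝ) :
    ∑ i, ∑ j, d i * d j * (f i - f j) ^ 2
      = 2 * ((∑ i, d i) * ∑ i, d i * f i ^ 2) - 2 * (∑ i, d i * f i) ^ 2 := by
  have h : ∀ i j, d i * d j * (f i - f j) ^ 2
      = (d i * f i ^ 2) * d j + d i * (d j * f j ^ 2) - 2 * ((d i * f i) * (d j * f j)) := by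
    intro i j; ring
  simp_rw [h, Finset.sum_sub_distrib, Finset.sum_add_distrib, ← Finset.mul_sum,
    ← Finset.sum_mul]
  ring

lemma aux_poincare (n : ℕ) (w : Fin n → ℝ) (hw : ∀ i, 0 < w i)
    (d : Fin (n + 1) → ℝ) (hd : ∀ i, 0 ≤ d i) (W : ℝ) (hW : 0 < W) (hdW : ∑ i, d i = 2 * W)
    (f : Fin (n + 1) → ℝ) (hf : ∑ i, d i * f i = 0) :
    2 * ∑ i, d i * f i ^ 2
      ≤ W * (∑ k, (w k)⁻¹) * ∑ k : Fin n, w k * (f k.succ - f k.castSucc) ^ 2 := by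
  set E := ∑ k : Fin n, w k * (f k.succ - f k.castSucc) ^ 2 with hE
  let s : Fin n → Fin (n + 1) → ℝ := fun k i => if k.castSucc < i then 1 else 0
  have hE0 : 0 ≤ E := Finset.sum_nonneg fun k _ => mul_nonneg (hw k).le (sq_nonneg _)
  have hcs : ∀ i j, (f i - f j) ^ 2 ≤ E * ∑ k, (w k)⁻¹ * (s k i - s k j) ^ 2 := by
    intro i j
    have h1 : f i - f j = ∑ k : Fin n, (f k.succ - f k.castSucc) * (s k i - s k j) := by
      rw [aux_tele n f i, aux_tele n f j]
      simp_rw [mul_sub, Finset.sum_sub_distrib]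
      simp only [s]; ring
    rw [h1]
    refine Finset.sum_sq_le_sum_mul_sum_of_sq_le_mul _ ?_ ?_ ?_
    · intro k _; exact mul_nonneg (hw k).le (sq_nonneg _)
    · intro k _; exact mul_nonneg (inv_nonneg.2 (hw k).le) (sq_nonneg _)
    · intro k _
      have := (hw k).ne'
      refine le_of_eq ?_
      field_simp
  have h1 : ∑ i, ∑ j, d i * d j * (f i - f j) ^ 2
      ≤ ∑ i, ∑ j, d i * d j * (E * ∑ k, (w k)⁻¹ * (s k i - s k j) ^ 2) :=
    Finset.sum_le_sum fun i _ => Finset.sum_le_sum fun j _ =>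
      mul_le_mul_of_nonneg_left (hcs i j) (mul_nonneg (hd i) (hd j))
  have h2 : ∑ i, ∑ j, d i * d j * (E * ∑ k, (w k)⁻¹ * (s k i - s k j) ^ 2)
      = E * ∑ k, (w k)⁻¹ * ∑ i, ∑ j, d i * d j * (s k i - s k j) ^ 2 := by
    simp_rw [Finset.mul_sum]
    rw [Finset.sum_congr rfl (fun i _ => Finset.sum_comm), Finset.sum_comm]
    refine Finset.sum_congr rfl fun k _ => Finset.sum_congr rfl fun i _ =>
      Finset.sum_congr rfl fun j _ => by ring
  have h3 : ∑ k, (w k)⁻¹ * ∑ i, ∑ j, d i * d j * (s k i - s k j) ^ 2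
      ≤ ∑ k, (w k)⁻¹ * (2 * W ^ 2) := by
    refine Finset.sum_le_sum fun k _ => mul_le_mul_of_nonneg_left ?_ (inv_nonneg.2 (hw k).le)
    rw [aux_pair, hdW]
    have : ∀ i, d i * s k i ^ 2 = d i * s k i := by
      intro i; simp only [s]; split_ifs <;> simp
    simp_rw [this]
    nlinarith [sq_nonneg (∑ i, d i * s k i - W)]
  rw [h2, aux_pair, hdW, hf] at h1
  rw [← Finset.sum_mul] at h3
  have h4 := h1.trans (mul_le_mul_of_nonneg_left h3 hE0)
  have : (2 * W) * (2 * ∑ i, d i * f i ^ 2) ≤ (2 * W) * (W * (∑ k, (w k)⁻¹) * E) := by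
    nlinarith
  exact le_of_mul_le_mul_left this (by positivity)

lemma aux_eig {m : ℕ} (A : Matrix (Fin m) (Fin m) ℝ) (hA : A.IsHermitian)
    (ev : Fin m → ℝ) (hev : A.charpoly = ∏ i, (X - C (ev i))) (i j : Fin m) (hij : i ≠ j)
    (c : Fin m → ℝ) (β : ℝ) (hi : ev i < β) (hj : ev j < β) :
    ∃ x : Fin m → ℝ, c ⬝ᵥ x = 0 ∧ x ⬝ᵥ (A.mulVec x) < β * (x ⬝ᵥ x) := by
  have hr : Finset.univ.val.map ev = Finset.univ.val.map hA.eigenvalues := by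
    have h1 := hA.roots_charpoly_eq_eigenvalues
    rw [hev, Polynomial.roots_prod _ _ (Finset.prod_ne_zero_iff.2 fun i _ => X_sub_C_ne_zero _)] at h1
    simpa using h1
  have hcount : ∀ g : Fin m → ℝ, (Finset.univ.filter fun k => g k < β).card
      = ((Finset.univ.val.map g).filter fun y => y < β).card := by
    intro g
    rw [Multiset.filter_map, Multiset.card_map]
    rfl
  have hc : 1 < (Finset.univ.filter fun k => hA.eigenvalues k < β).card := by
    rw [hcount, ← hr, ← hcount]
    exact Finset.one_lt_card.2 ⟨i, by simpa using hi, j, by simpa using hj, hij⟩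
  obtain ⟨p, hp, q, hq, hne⟩ := Finset.one_lt_card.1 hc
  replace hp : hA.eigenvalues p < β := by simpa using hp
  replace hq : hA.eigenvalues q < β := by simpa using hq
  have key : ∀ p q : Fin m, (hA.eigenvectorBasis p).ofLp ⬝ᵥ (hA.eigenvectorBasis q).ofLp
      = if p = q then 1 else 0 := by
    intro p q
    have := orthonormal_iff_ite.1 hA.eigenvectorBasis.orthonormal p q
    rw [← this, EuclideanSpace.inner_eq_star_dotProduct, dotProduct_comm]
    simp
  set u : Fin m → ℝ := (hA.eigenvectorBasis p).ofLp with hu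
  set v : Fin m → ℝ := (hA.eigenvectorBasis q).ofLp with hv
  have uu : u ⬝ᵥ u = 1 := by simp [hu, key]
  have vv : v ⬝ᵥ v = 1 := by simp [hv, key]
  have uv : u ⬝ᵥ v = 0 := by rw [hu, hv, key, if_neg hne]
  have vu : v ⬝ᵥ u = 0 := by rw [dotProduct_comm, uv]
  have Au : A.mulVec u = hA.eigenvalues p • u := hA.mulVec_eigenvectorBasis p
  have Av : A.mulVec v = hA.eigenvalues q • v := hA.mulVec_eigenvectorBasis q
  have main : ∀ a b : ℝ, (a ≠ 0 ∨ b ≠ 0) → a * (c ⬝ᵥ u) + b * (c ⬝ᵥ v) = 0 →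
      ∃ x : Fin m → ℝ, c ⬝ᵥ x = 0 ∧ x ⬝ᵥ (A.mulVec x) < β * (x ⬝ᵥ x) := by
    intro a b hab h0
    refine ⟨a • u + b • v, ?_, ?_⟩
    · simpa [dotProduct_add, dotProduct_smul] using h0
    · simp only [Matrix.mulVec_add, Matrix.mulVec_smul, Au, Av, dotProduct_add, add_dotProduct,
        dotProduct_smul, smul_dotProduct, uu, vv, uv, vu, smul_eq_mul]
      rcases hab with h | h
      · have := mul_lt_mul_of_pos_left hp (pow_pos (abs_pos.2 h) 2)
        rw [sq_abs] at this
        nlinarith [mul_le_mul_of_nonneg_left hq.le (sq_nonneg b)]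
      · have := mul_lt_mul_of_pos_left hq (pow_pos (abs_pos.2 h) 2)
        rw [sq_abs] at this
        nlinarith [mul_le_mul_of_nonneg_left hp.le (sq_nonneg a)]
  by_cases h : c ⬝ᵥ u = 0
  · exact main 1 0 (by simp) (by simp [h])
  · exact main (c ⬝ᵥ v) (-(c ⬝ᵥ u)) (by simp [h]) (by ring)

open Polynomial

/-- Let `Γ` be the weighted path graph on vertices `0, 1, …, n` with
edge weights `μ(i-1, i) = w i > 0`. Then the second-smallest eigenvalue `α₂(Γ)` of the
symmetric normalized Laplacian of `Γ` satisfies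
`α₂(Γ) ≥ 2 / ((∑ w i) · (∑ 1 / w i))`. The increasing eigenvalue list (with
multiplicity) is encoded by a monotone tuple `ev` factoring the characteristic
polynomial, so that `α₂(Γ) = ev 1`. -/
theorem stmt_14 (n : ℕ) (hn : 1 ≤ n) (w : Fin n → ℝ) (hw : ∀ i, 0 < w i)
    (μ : Fin (n + 1) → Fin (n + 1) → ℝ)
    (hμ : ∀ i j, μ i j =
      if h : (i : ℕ) + 1 = (j : ℕ) then w ⟨(i : ℕ), by have := j.isLt; omega⟩
      else if h' : (j : ℕ) + 1 = (i : ℕ) then w ⟨(j : ℕ), by have := i.isLt; omega⟩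
      else 0)
    (d : Fin (n + 1) → ℝ) (hd : ∀ i, d i = ∑ j, μ i j)
    (Λ : Matrix (Fin (n + 1)) (Fin (n + 1)) ℝ)
    (hΛ : ∀ i j, Λ i j = (if i = j then 1 else 0) - μ i j / Real.sqrt (d i * d j))
    (ev : Fin (n + 1) → ℝ) (hmono : Monotone ev)
    (hev : Λ.charpoly = ∏ i, (X - C (ev i))) :
    ev ⟨1, by omega⟩ ≥ 2 / ((∑ i, w i) * (∑ i, (w i)⁻¹)) := by
  have hμ' := aux_mu n w μ
    (fun k => by rw [hμ, dif_pos (by simp)]; rfl)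
    (fun k => by rw [hμ, dif_neg (by simp; omega), dif_pos (by simp)]; rfl)
    (fun i j h h' => by rw [hμ, dif_neg h, dif_neg h'])
  have hS := aux_sum n w μ hμ'
  have hsym : ∀ i j, μ i j = μ j i := by
    intro i j; rw [hμ', hμ']
    refine Finset.sum_congr rfl fun k _ => ?_
    simp only [← ite_and]
    rw [add_comm]
    congr 1 <;> simp only [and_comm]
  have hμ0 : ∀ i j, 0 ≤ μ i j := by
    intro i j; rw [hμ]; split_ifs
    · exact (hw _).le
    · exact (hw _).le
    · exact le_rfl
  have hdpos : ∀ i, 0 < d i := by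
    intro i
    rw [hd]
    by_cases hi : (i : ℕ) < n
    · refine Finset.sum_pos' (fun j _ => hμ0 i j) ⟨⟨i + 1, by omega⟩, Finset.mem_univ _, ?_⟩
      rw [hμ, dif_pos rfl]; exact hw _
    · have := i.isLt
      refine Finset.sum_pos' (fun j _ => hμ0 i j) ⟨⟨i - 1, by omega⟩, Finset.mem_univ _, ?_⟩
      rw [hμ, dif_neg (by simp; omega), dif_pos (by simp; omega)]; exact hw _
  have hne : (Finset.univ : Finset (Fin n)).Nonempty := ⟨⟨0, hn⟩, Finset.mem_univ _⟩
  have hW : 0 < ∑ i, w i := Finset.sum_pos (fun i _ => hw i) hne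
  have hR : 0 < ∑ i, (w i)⁻¹ := Finset.sum_pos (fun i _ => inv_pos.2 (hw i)) hne
  have hdW : ∑ i, d i = 2 * ∑ i, w i := by
    have := hS (fun _ _ => 1)
    simp only [mul_one] at this
    simp_rw [hd, this, ← Finset.sum_mul]; ring
  have hA : Λ.IsHermitian := by
    ext i j
    simp only [Matrix.conjTranspose_apply, star_trivial, hΛ]
    rw [hsym j i, mul_comm (d j)]
    simp only [eq_comm]
  by_contra hcon
  rw [ge_iff_le, not_le] at hcon
  have h0 : ev 0 < 2 / ((∑ i, w i) * (∑ i, (w i)⁻¹)) :=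
    lt_of_le_of_lt (hmono (Fin.zero_le _)) hcon
  obtain ⟨x, hx1, hx2⟩ := aux_eig Λ hA ev hev 0 ⟨1, by omega⟩
    (by intro h; have := congrArg Fin.val h; simp at this)
    (fun i => Real.sqrt (d i)) _ h0 hcon
  let f : Fin (n + 1) → ℝ := fun i => x i / Real.sqrt (d i)
  have hsq : ∀ i, 0 < Real.sqrt (d i) := fun i => Real.sqrt_pos.2 (hdpos i)
  have hxf : ∀ i, x i = Real.sqrt (d i) * f i := by
    intro i; simp only [f]; field_simp [(hsq i).ne']
  have hss : ∀ i, Real.sqrt (d i) * Real.sqrt (d i) = d i := fun i => Real.mul_self_sqrt (hdpos i).le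
  have hf : ∑ i, d i * f i = 0 := by
    rw [← hx1]
    refine Finset.sum_congr rfl fun i _ => ?_
    rw [hxf, ← mul_assoc, hss]
  have hxx : x ⬝ᵥ x = ∑ i, d i * f i ^ 2 := by
    refine Finset.sum_congr rfl fun i _ => ?_
    rw [hxf, ← hss i, Real.sqrt_mul_self (hsq i).le]; ring
  have hP := aux_poincare n w hw d (fun i => (hdpos i).le) _ hW hdW f hf
  have hQ : x ⬝ᵥ (Λ.mulVec x) = ∑ k : Fin n, w k * (f k.succ - f k.castSucc) ^ 2 := by
    have e1 : x ⬝ᵥ (Λ.mulVec x) = ∑ i, d i * f i ^ 2 - ∑ i, ∑ j, μ i j * (f i * f j) := by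
      rw [← hxx, dotProduct, dotProduct, ← Finset.sum_sub_distrib]
      refine Finset.sum_congr rfl fun i _ => ?_
      have : Λ.mulVec x i = x i - ∑ j, μ i j / Real.sqrt (d i * d j) * x j := by
        simp [Matrix.mulVec, dotProduct, hΛ, sub_mul, Finset.sum_sub_distrib]
      rw [this, mul_sub, Finset.mul_sum]
      congr 1
      refine Finset.sum_congr rfl fun j _ => ?_
      rw [Real.sqrt_mul (hdpos i).le]
      simp only [f]
      have := (hsq i).ne'
      have := (hsq j).ne'
      rw [hxf i, hxf j]
      simp only [f]
      field_simp
    have e2 : ∑ i, d i * f i ^ 2 = ∑ i, ∑ j, μ i j * (f i ^ 2) := by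
      simp_rw [hd, Finset.sum_mul]
    rw [e1, e2, hS (fun i _ => f i ^ 2), hS (fun i j => f i * f j), ← Finset.sum_sub_distrib]
    refine Finset.sum_congr rfl fun k _ => by ring
  rw [hQ, hxx, div_mul_eq_mul_div, lt_div_iff₀ (mul_pos hW hR)] at hx2
  linarith
end
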